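/- Let t : ℕ → Bool be the Thue–Morse sequence and let b : ℕ → β be a sequence over an alphabet β whose palindromic length sequence coincides with that of t, i.e. P_b(n) = P_t(n) for every n ∈ ℕ. Then for every k ∈ ℕ the block b(4k)b(4k+1)b(4k+2)b(4k+3) is of the form x y y x with x ≠ y, i.e. b(4k) = b(4k+3), b(4k+1) = b(4k+2) and b(4k) ≠ b(4k+1). -/

import Mathlib

/-- Membership in the class 𝒞: there exist a letter `c`, bijections `f n`,
and words `w n` with `w 0 = [c]`,
`w (n+1) = w n ++ f n (w n) ++ f n (w n) ++ w n`, `f n (w n) ≠ w n`,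
and `w n` is the prefix of `a` of length `4 ^ n`. -/
def InC {α : Type*} (a : ℕ → α) : Prop :=
  ∃ (c : α) (f : ℕ → α ≃ α) (w : ℕ → List α),
    w 0 = [c] ∧
    (∀ n, w (n + 1) = w n ++ (w n).map (f n) ++ (w n).map (f n) ++ w n) ∧
    (∀ n, (w n).map (f n) ≠ w n) ∧
    (∀ n, w n = (List.range (4 ^ n)).map a)

/-- The factor `a(x) a(x+1) ⋯ a(x+y-1)` of the sequence `a`. -/
def factor {α : Type*} (a : ℕ → α) (x y : ℕ) : List α :=
  (List.range y).map (fun i => a (x + i))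

/-- The prefix of `a` of length `n`. -/
def prefixWord {α : Type*} (a : ℕ → α) (n : ℕ) : List α :=
  factor a 0 n

/-- The palindromic length of a finite word: the least number of palindromes
whose concatenation is the word (0 for the empty word). -/
noncomputable def palLen {α : Type*} (w : List α) : ℕ :=
  sInf {k | ∃ ps : List (List α),
    ps.length = k ∧ (∀ p ∈ ps, p.Palindrome) ∧ ps.flatten = w}

/-- `P a n` is the palindromic length of the prefix of `a` of length `n`. -/
noncomputable def P {α : Type*} (a : ℕ → α) (n : ℕ) : ℕ :=
  palLen (prefixWord a n)

/-- The factor of length `y` at position `x` is embedded into the center of the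
factor of length `4 * r` at position `4 * z`. -/
def EmbedCenter (x y z r : ℕ) : Prop :=
  4 * z ≤ x ∧ x + y ≤ 4 * z + 4 * r ∧ x - 4 * z = (4 * z + 4 * r) - (x + y)

/-- The Thue–Morse sequence: `true` iff the number of ones in the binary
expansion is odd. -/
def thueMorse (n : ℕ) : Bool :=
  (Nat.digits 2 n).count 1 % 2 == 1

/-- The factor of `a` on the interval `[m, n)` is a palindrome. -/
def PalOn {α : Type*} (a : ℕ → α) (m n : ℕ) : Prop :=
  ∀ i j, m ≤ i → m ≤ j → i + j + 1 = m + n → a i = a j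

section PalOn

variable {α : Type*} {a : ℕ → α}

theorem PalOn.central {m n m' n' : ℕ} (h : PalOn a m n) (hm : m ≤ m') (hs : m' + n' = m + n) :
    PalOn a m' n' := fun i j hi hj hij => h i j (by omega) (by omega) (by omega)

theorem palOn_single (a : ℕ → α) (m : ℕ) : PalOn a m (m + 1) := by
  intro i j hi hj hij
  rw [show i = j by omega]

/-- The mirror image of a palindromic suffix of a palindrome is a palindromic prefix. -/
theorem PalOn.mirror {m s n : ℕ} (h : PalOn a m n) (h' : PalOn a s n) (hms : m ≤ s) :
    PalOn a m (m + n - s) := by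
  intro i j hi hj hij
  rw [h i (m + n - 1 - i) hi (by omega) (by omega), h j (m + n - 1 - j) hj (by omega) (by omega)]
  exact h' _ _ (by omega) (by omega) (by omega)

/-- A palindrome with a palindromic suffix removed is a product of two palindromes. -/
theorem PalOn.exists_split {m s : ℕ} (hms : m ≤ s) (n : ℕ) (hsn : s ≤ n) (h : PalOn a m n)
    (h' : PalOn a s n) : ∃ c, m ≤ c ∧ c ≤ s ∧ PalOn a m c ∧ PalOn a c s := by
  induction n using Nat.strong_induction_on with
  | _ n ih =>
    by_cases hd : n ≤ 2 * s - m
    · exact ⟨m + n - s, by omega, by omega, h.mirror h' hms, h.central (by omega) (by omega)⟩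
    · rcases hms.eq_or_lt with rfl | hlt
      · exact ⟨m, le_rfl, le_rfl, fun i j _ _ _ => by omega, fun i j _ _ _ => by omega⟩
      · exact ih (m + n - s) (by omega) (by omega) (h.mirror h' hms)
          (h.central (by omega) (by omega))

end PalOn

section PrefixPalLen

variable {α : Type*} {a : ℕ → α}

theorem length_factor (a : ℕ → α) (x y : ℕ) : (factor a x y).length = y := by
  simp [factor]

theorem prefixWord_add (a : ℕ → α) (m d : ℕ) :
    prefixWord a (m + d) = prefixWord a m ++ factor a m d := by
  simp [prefixWord, factor, List.range_add]

theorem palindrome_factor_iff (a : ℕ → α) (m d : ℕ) :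
    (factor a m d).Palindrome ↔ PalOn a m (m + d) := by
  rw [List.Palindrome.iff_reverse_eq]
  constructor
  · intro h i j hi hj hij
    have hl : (i - m) < (factor a m d).reverse.length := by
      rw [List.length_reverse, length_factor]; omega
    have := List.getElem_of_eq h hl
    simp only [factor, List.getElem_reverse, List.getElem_map, List.getElem_range,
      List.length_map, List.length_range] at this
    rw [show m + (d - 1 - (i - m)) = j by omega, show m + (i - m) = i by omega] at this
    exact this.symm
  · intro h
    refine List.ext_getElem (by simp) fun i h1 h2 => ?_
    rw [length_factor] at h2
    simp only [factor, List.getElem_reverse, List.getElem_map, List.getElem_range,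
      List.length_map, List.length_range]
    exact h _ _ (by omega) (by omega) (by omega)

theorem palLen_le {w : List α} (ps : List (List α)) (hp : ∀ p ∈ ps, p.Palindrome)
    (hw : ps.flatten = w) : palLen w ≤ ps.length :=
  Nat.sInf_le ⟨ps, rfl, hp, hw⟩

theorem exists_palLen (w : List α) :
    ∃ ps : List (List α), ps.length = palLen w ∧ (∀ p ∈ ps, p.Palindrome) ∧ ps.flatten = w := by
  refine Nat.sInf_mem (s := {k | ∃ ps : List (List α),
    ps.length = k ∧ (∀ p ∈ ps, p.Palindrome) ∧ ps.flatten = w}) ?_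
  refine ⟨_, w.map fun x => [x], rfl, ?_, ?_⟩
  · intro p hp
    obtain ⟨x, -, rfl⟩ := List.mem_map.1 hp
    exact List.Palindrome.singleton x
  · induction w <;> simp_all

theorem P_zero (a : ℕ → α) : P a 0 = 0 :=
  Nat.le_zero.1 (palLen_le [] (by simp) (by simp [prefixWord, factor]))

theorem PalOn.P_le {m n : ℕ} (hmn : m ≤ n) (h : PalOn a m n) : P a n ≤ P a m + 1 := by
  obtain ⟨d, rfl⟩ := Nat.exists_eq_add_of_le hmn
  obtain ⟨ps, hl, hp, hf⟩ := exists_palLen (prefixWord a m)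
  have := palLen_le (w := prefixWord a (m + d)) (ps ++ [factor a m d])
    (by
      intro p hp'
      rcases List.mem_append.1 hp' with h1 | h1
      · exact hp p h1
      · rw [List.mem_singleton.1 h1]
        exact (palindrome_factor_iff a m d).2 h)
    (by simp [hf, prefixWord_add])
  rw [List.length_append, hl] at this
  exact this

theorem exists_palOn_P_succ_le (a : ℕ → α) {n : ℕ} (hn : 0 < n) :
    ∃ m < n, PalOn a m n ∧ P a m + 1 ≤ P a n := by
  obtain ⟨ps, hl, hp, hf⟩ := exists_palLen (prefixWord a n)
  rcases List.eq_nil_or_concat ps with rfl | ⟨qs, p, rfl⟩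
  · have := congrArg List.length hf
    rw [prefixWord, length_factor] at this
    simp at this
    omega
  · rw [List.concat_eq_append] at *
    rw [List.flatten_append, List.flatten_singleton] at hf
    have hlen := congrArg List.length hf
    rw [List.length_append, prefixWord, length_factor] at hlen
    have hqs : ∀ q ∈ qs, q.Palindrome := fun q hq => hp q (List.mem_append_left _ hq)
    rw [← hlen, prefixWord_add] at hf
    obtain ⟨h1, h2⟩ := List.append_inj hf (by rw [prefixWord, length_factor])
    have hP : P a qs.flatten.length ≤ qs.length := palLen_le qs hqs h1
    have hl' : qs.length + 1 = P a n := by simpa [P] using hl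
    refine ⟨qs.flatten.length, ?_, ?_, by omega⟩
    · by_contra hlt
      rw [show qs.flatten.length = n by omega] at hP
      omega
    · rw [← hlen, ← palindrome_factor_iff, ← h2]
      exact hp p (by simp)

/-- Removing a palindromic suffix increases the palindromic length by at most one. -/
theorem PalOn.P_le_succ {m n : ℕ} (hmn : m ≤ n) (h : PalOn a m n) : P a m ≤ P a n + 1 := by
  induction n using Nat.strong_induction_on generalizing m with
  | _ n ih =>
    rcases Nat.eq_zero_or_pos n with rfl | hn
    · rw [Nat.le_zero.1 hmn]; omega
    obtain ⟨s, hs, hsn, hP⟩ := exists_palOn_P_succ_le a hn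
    rcases le_total s m with hsm | hms
    · obtain ⟨c, h1, h2, h3, h4⟩ := PalOn.exists_split hsm n hmn hsn h
      have := h3.P_le h1
      have := h4.P_le h2
      omega
    · obtain ⟨c, h1, h2, h3, h4⟩ := PalOn.exists_split hms n hs.le h hsn
      have := ih c (by omega) h1 h3
      have := ih s hs h2 h4
      omega

end PrefixPalLen

section ThueMorse

theorem thueMorse_two_mul (n : ℕ) : thueMorse (2 * n) = thueMorse n := by
  rcases Nat.eq_zero_or_pos n with rfl | hn
  · rfl
  · rw [thueMorse, thueMorse, Nat.digits_def' (by norm_num) (by omega)]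
    simp

theorem thueMorse_two_mul_add_one (n : ℕ) : thueMorse (2 * n + 1) = !thueMorse n := by
  rw [thueMorse, thueMorse, Nat.digits_def' (by norm_num) (by omega),
    show (2 * n + 1) % 2 = 1 by omega, show (2 * n + 1) / 2 = n by omega, List.count_cons_self]
  rcases Nat.mod_two_eq_zero_or_one (List.count 1 (Nat.digits 2 n)) with h | h <;>
    simp [Nat.add_mod, h]

theorem thueMorse_four_mul (n : ℕ) : thueMorse (4 * n) = thueMorse n := by
  rw [show 4 * n = 2 * (2 * n) by ring, thueMorse_two_mul, thueMorse_two_mul]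

theorem thueMorse_four_mul_add_one (n : ℕ) : thueMorse (4 * n + 1) = !thueMorse n := by
  rw [show 4 * n + 1 = 2 * (2 * n) + 1 by ring, thueMorse_two_mul_add_one, thueMorse_two_mul]

theorem thueMorse_four_mul_add_two (n : ℕ) : thueMorse (4 * n + 2) = !thueMorse n := by
  rw [show 4 * n + 2 = 2 * (2 * n + 1) by ring, thueMorse_two_mul, thueMorse_two_mul_add_one]

theorem thueMorse_four_mul_add_three (n : ℕ) : thueMorse (4 * n + 3) = thueMorse n := by
  rw [show 4 * n + 3 = 2 * (2 * n + 1) + 1 by ring, thueMorse_two_mul_add_one,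
    thueMorse_two_mul_add_one, Bool.not_not]

theorem exists_four_mul_add (m : ℕ) :
    ∃ k, m = 4 * k ∨ m = 4 * k + 1 ∨ m = 4 * k + 2 ∨ m = 4 * k + 3 :=
  ⟨m / 4, by omega⟩

theorem PalOn.thueMorse_four_mul {m n : ℕ} (h : PalOn thueMorse m n) :
    PalOn thueMorse (4 * m) (4 * n) := by
  intro i j hi hj hij
  obtain ⟨k, rfl | rfl | rfl | rfl⟩ := exists_four_mul_add i <;>
  obtain ⟨l, rfl | rfl | rfl | rfl⟩ := exists_four_mul_add j <;>
  first
  | omega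
  | (have := h k l (by omega) (by omega) (by omega)
     simp only [_root_.thueMorse_four_mul, thueMorse_four_mul_add_one, thueMorse_four_mul_add_two,
       thueMorse_four_mul_add_three, this])

theorem PalOn.of_thueMorse_four_mul {m n : ℕ} (h : PalOn thueMorse (4 * m + 1) (4 * n + 3)) :
    PalOn thueMorse m (n + 1) := by
  intro i j hi hj hij
  have := h (4 * i + 1) (4 * j + 2) (by omega) (by omega) (by omega)
  simpa only [thueMorse_four_mul_add_one, thueMorse_four_mul_add_two, Bool.not_inj_iff] using this

/-- No palindrome of length `5` occurs in the Thue–Morse sequence. -/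
theorem not_palOn_thueMorse_add_five (m : ℕ) : ¬ PalOn thueMorse m (m + 5) := by
  intro h
  have h0 := h m (m + 4) (by omega) (by omega) (by omega)
  have h1 := h (m + 1) (m + 3) (by omega) (by omega) (by omega)
  obtain ⟨k, rfl | rfl | rfl | rfl⟩ := exists_four_mul_add m <;>
  simp only [Nat.add_assoc, Nat.reduceAdd, show 4 * k + 4 = 4 * (k + 1) by ring,
    show 4 * k + 5 = 4 * (k + 1) + 1 by ring, show 4 * k + 6 = 4 * (k + 1) + 2 by ring,
    show 4 * k + 7 = 4 * (k + 1) + 3 by ring, thueMorse_four_mul, thueMorse_four_mul_add_one,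
    thueMorse_four_mul_add_two, thueMorse_four_mul_add_three] at h0 h1 <;>
  revert h0 h1 <;> cases thueMorse k <;> cases thueMorse (k + 1) <;> decide

/-- The solution of the recurrences satisfied by the palindromic lengths of the prefixes of the
Thue–Morse sequence. -/
def tmPalLen (n : ℕ) : ℕ :=
  if n = 0 then 0
  else if n % 4 = 0 then tmPalLen (n / 4)
  else if n % 4 = 1 then tmPalLen (n / 4) + 1
  else if n % 4 = 2 then min (tmPalLen (n / 4)) (tmPalLen (n / 4 + 1)) + 2
  else tmPalLen (n / 4 + 1) + 1
termination_by n
decreasing_by all_goals omega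

theorem tmPalLen_zero : tmPalLen 0 = 0 := by rw [tmPalLen]; rfl

theorem tmPalLen_four_mul (k : ℕ) : tmPalLen (4 * k) = tmPalLen k := by
  rcases Nat.eq_zero_or_pos k with rfl | hk
  · rfl
  · rw [tmPalLen, if_neg (by omega), if_pos (by omega), show 4 * k / 4 = k by omega]

theorem tmPalLen_four_mul_add_one (k : ℕ) : tmPalLen (4 * k + 1) = tmPalLen k + 1 := by
  rw [tmPalLen, if_neg (by omega), if_neg (by omega), if_pos (by omega),
    show (4 * k + 1) / 4 = k by omega]

theorem tmPalLen_four_mul_add_two (k : ℕ) :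
    tmPalLen (4 * k + 2) = min (tmPalLen k) (tmPalLen (k + 1)) + 2 := by
  rw [tmPalLen, if_neg (by omega), if_neg (by omega), if_neg (by omega), if_pos (by omega),
    show (4 * k + 2) / 4 = k by omega]

theorem tmPalLen_four_mul_add_three (k : ℕ) : tmPalLen (4 * k + 3) = tmPalLen (k + 1) + 1 := by
  rw [tmPalLen, if_neg (by omega), if_neg (by omega), if_neg (by omega), if_neg (by omega),
    show (4 * k + 3) / 4 = k by omega]

theorem tmPalLen_succ (n : ℕ) :
    tmPalLen (n + 1) ≤ tmPalLen n + 1 ∧ tmPalLen n ≤ tmPalLen (n + 1) + 1 := by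
  induction n using Nat.strong_induction_on with
  | _ n ih =>
    obtain ⟨k, hk⟩ := exists_four_mul_add n
    have h0 := tmPalLen_four_mul k
    have h1 := tmPalLen_four_mul_add_one k
    have h2 := tmPalLen_four_mul_add_two k
    have h3 := tmPalLen_four_mul_add_three k
    have h4 := tmPalLen_four_mul (k + 1)
    rw [show 4 * (k + 1) = 4 * k + 3 + 1 by ring] at h4
    rcases hk with rfl | rfl | rfl | rfl
    · omega
    · have := ih k (by omega)
      simp only [Nat.add_assoc, Nat.reduceAdd]
      omega
    · have := ih k (by omega)
      simp only [Nat.add_assoc, Nat.reduceAdd]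
      omega
    · omega

theorem tmPalLen_add_three {m : ℕ} (h : thueMorse m = thueMorse (m + 2)) :
    tmPalLen (m + 3) ≤ tmPalLen m + 1 ∧ tmPalLen m ≤ tmPalLen (m + 3) + 1 := by
  obtain ⟨k, rfl | rfl | rfl | rfl⟩ := exists_four_mul_add m
  · simp [thueMorse_four_mul, thueMorse_four_mul_add_two] at h
  · simp [thueMorse_four_mul_add_one, thueMorse_four_mul_add_three] at h
  · have h1 := tmPalLen_four_mul_add_two k
    have h2 := tmPalLen_four_mul_add_one (k + 1)
    rw [show 4 * (k + 1) + 1 = 4 * k + 2 + 3 by ring] at h2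
    have := tmPalLen_succ k
    omega
  · have h1 := tmPalLen_four_mul_add_three k
    have h2 := tmPalLen_four_mul_add_two (k + 1)
    rw [show 4 * (k + 1) + 2 = 4 * k + 3 + 3 by ring] at h2
    have := tmPalLen_succ (k + 1)
    omega

/-- A nonempty palindrome of even length in the Thue–Morse sequence is centered at an even
position. -/
theorem PalOn.thueMorse_even_center {m c : ℕ} (hm : m < c) (h : PalOn thueMorse m (2 * c - m)) :
    Even c := by
  by_contra hc
  obtain ⟨j, rfl⟩ := Nat.not_even_iff_odd.1 hc
  have := h (2 * j) (2 * j + 1) (by omega) (by omega) (by omega)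
  simp [thueMorse_two_mul, thueMorse_two_mul_add_one] at this

theorem thueMorse_block_palOn {u v : ℕ} (h : PalOn thueMorse (4 * u + 2) (4 * v + 2))
    (huv : u < v) : PalOn thueMorse u (v + 1) := by
  intro i j hi hj hij
  by_cases hi' : i = u
  · have := h (4 * i + 3) (4 * j) (by omega) (by omega) (by omega)
    simpa only [thueMorse_four_mul_add_three, thueMorse_four_mul] using this
  by_cases hj' : j = u
  · have := h (4 * i) (4 * j + 3) (by omega) (by omega) (by omega)
    simpa only [thueMorse_four_mul_add_three, thueMorse_four_mul] using this
  · have := h (4 * i + 3) (4 * j) (by omega) (by omega) (by omega)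
    simpa only [thueMorse_four_mul_add_three, thueMorse_four_mul] using this

theorem PalOn.tmPalLen_le {m n : ℕ} (hmn : m ≤ n) (h : PalOn thueMorse m n) :
    tmPalLen n ≤ tmPalLen m + 1 ∧ tmPalLen m ≤ tmPalLen n + 1 := by
  induction n using Nat.strong_induction_on generalizing m with
  | _ n ih =>
    rcases hmn.eq_or_lt with rfl | hlt
    · omega
    rcases Nat.even_or_odd' (m + n) with ⟨c, hc | hc⟩
    · have heven : Even c := by
        refine PalOn.thueMorse_even_center (m := m) (by omega) ?_
        rwa [show 2 * c - m = n by omega]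
      obtain ⟨d, hd⟩ := heven
      obtain ⟨u, rfl | rfl | rfl | rfl⟩ := exists_four_mul_add m
      · obtain ⟨v, rfl⟩ : ∃ v, n = 4 * v := ⟨n / 4, by omega⟩
        have hp : PalOn thueMorse u v := by
          intro i j hi hj hij
          have := h (4 * i) (4 * j + 3) (by omega) (by omega) (by omega)
          simpa only [thueMorse_four_mul_add_three, _root_.thueMorse_four_mul] using this
        have := ih v (by omega) (by omega) hp
        rwa [tmPalLen_four_mul, tmPalLen_four_mul]
      · obtain ⟨v, rfl⟩ : ∃ v, n = 4 * v + 3 := ⟨n / 4, by omega⟩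
        have := ih (v + 1) (by omega) (by omega) h.of_thueMorse_four_mul
        rw [tmPalLen_four_mul_add_one, tmPalLen_four_mul_add_three]
        omega
      · obtain ⟨v, rfl⟩ : ∃ v, n = 4 * v + 2 := ⟨n / 4, by omega⟩
        have hp := thueMorse_block_palOn h (by omega)
        have h1 := ih (v + 1) (by omega) (by omega) hp
        have h2 := ih v (by omega) (by omega)
          (hp.central (m' := u + 1) (by omega) (by omega))
        rw [tmPalLen_four_mul_add_two, tmPalLen_four_mul_add_two]
        omega
      · obtain ⟨v, rfl⟩ : ∃ v, n = 4 * v + 1 := ⟨n / 4, by omega⟩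
        have hp : PalOn thueMorse (u + 1) v := by
          intro i j hi hj hij
          have := h (4 * i) (4 * j + 3) (by omega) (by omega) (by omega)
          simpa only [thueMorse_four_mul_add_three, _root_.thueMorse_four_mul] using this
        have := ih v (by omega) (by omega) hp
        rw [tmPalLen_four_mul_add_one, tmPalLen_four_mul_add_three]
        omega
    · rcases (by omega : n = m + 1 ∨ n = m + 3 ∨ m + 5 ≤ n) with rfl | rfl | h5
      · exact tmPalLen_succ m
      · exact tmPalLen_add_three (h m (m + 2) (by omega) (by omega) (by omega))
      · exact absurd (h.central (m' := c - 2) (by omega) (by omega))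
          (not_palOn_thueMorse_add_five (c - 2))

theorem exists_palOn_tmPalLen {n : ℕ} (hn : 0 < n) :
    ∃ m < n, PalOn thueMorse m n ∧ tmPalLen m + 1 ≤ tmPalLen n := by
  induction n using Nat.strong_induction_on with
  | _ n ih =>
    obtain ⟨k, rfl | rfl | rfl | rfl⟩ := exists_four_mul_add n
    · obtain ⟨m, hm, hp, hq⟩ := ih k (by omega) (by omega)
      refine ⟨4 * m, by omega, hp.thueMorse_four_mul, ?_⟩
      rwa [tmPalLen_four_mul, tmPalLen_four_mul]
    · refine ⟨4 * k, by omega, palOn_single _ _, ?_⟩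
      rw [tmPalLen_four_mul, tmPalLen_four_mul_add_one]
    · by_cases hk : tmPalLen k ≤ tmPalLen (k + 1)
      · refine ⟨4 * k + 1, by omega, palOn_single _ _, ?_⟩
        rw [tmPalLen_four_mul_add_one, tmPalLen_four_mul_add_two, min_eq_left hk]
      · obtain ⟨m, hm, hp, hq⟩ := ih (k + 1) (by omega) (by omega)
        have hmk : m ≠ k := by rintro rfl; omega
        refine ⟨4 * m + 2, by omega, hp.thueMorse_four_mul.central (by omega) (by omega), ?_⟩
        rw [tmPalLen_four_mul_add_two, tmPalLen_four_mul_add_two]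
        omega
    · obtain ⟨m, hm, hp, hq⟩ := ih (k + 1) (by omega) (by omega)
      refine ⟨4 * m + 1, by omega, hp.thueMorse_four_mul.central (by omega) (by omega), ?_⟩
      rw [tmPalLen_four_mul_add_one, tmPalLen_four_mul_add_three]
      omega

theorem P_thueMorse (n : ℕ) : P thueMorse n = tmPalLen n := by
  induction n using Nat.strong_induction_on with
  | _ n ih =>
    rcases Nat.eq_zero_or_pos n with rfl | hn
    · rw [P_zero, tmPalLen_zero]
    obtain ⟨m, hm, hp, hq⟩ := exists_palOn_tmPalLen hn
    obtain ⟨m', hm', hp', hq'⟩ := exists_palOn_P_succ_le thueMorse hn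
    have := hp.P_le hm.le
    have := (hp'.tmPalLen_le hm'.le).1
    rw [ih m hm] at *
    rw [ih m' hm'] at *
    omega

end ThueMorse

section Reconstruction

variable {β : Type*} {b : ℕ → β}

theorem PalOn.tmPalLen_le_of_P_eq (hP : ∀ n, P b n = tmPalLen n) {m n : ℕ} (hmn : m ≤ n)
    (h : PalOn b m n) : tmPalLen n ≤ tmPalLen m + 1 ∧ tmPalLen m ≤ tmPalLen n + 1 := by
  rw [← hP, ← hP]
  exact ⟨h.P_le hmn, h.P_le_succ hmn⟩

theorem apply_ne_apply_succ (hP : ∀ n, P b n = tmPalLen n) {k : ℕ}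
    (hk : tmPalLen k ≤ tmPalLen (k + 1)) : b (4 * k) ≠ b (4 * k + 1) := by
  intro h
  have hp : PalOn b (4 * k) (4 * k + 2) := by
    intro i j hi hj hij
    rcases (by omega : i = 4 * k ∧ j = 4 * k + 1 ∨ i = 4 * k + 1 ∧ j = 4 * k) with
      ⟨rfl, rfl⟩ | ⟨rfl, rfl⟩
    exacts [h, h.symm]
  have := hp.tmPalLen_le_of_P_eq hP (by omega)
  rw [tmPalLen_four_mul, tmPalLen_four_mul_add_two] at this
  omega

/-- If `tmPalLen` increases twice in a row, this happens at a multiple of four. -/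
theorem exists_eq_four_mul_of_increasing {m : ℕ} (h1 : tmPalLen (m + 1) = tmPalLen m + 1)
    (h2 : tmPalLen (m + 2) = tmPalLen m + 2) :
    ∃ l, m = 4 * l ∧ tmPalLen l ≤ tmPalLen (l + 1) := by
  obtain ⟨k, hk⟩ := exists_four_mul_add m
  have e0 := tmPalLen_four_mul k
  have e1 := tmPalLen_four_mul_add_one k
  have e2 := tmPalLen_four_mul_add_two k
  have e3 := tmPalLen_four_mul_add_three k
  have e4 := tmPalLen_four_mul (k + 1)
  rw [show 4 * (k + 1) = 4 * k + 4 by ring] at e4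
  have := tmPalLen_succ k
  rcases hk with rfl | rfl | rfl | rfl
  · exact ⟨k, rfl, by omega⟩
  all_goals
    simp only [Nat.add_assoc, Nat.reduceAdd] at h1 h2
    omega

/-- An optimal last palindrome ending at `4 * (k + 1)` is aligned to blocks of length four, or else
starts at the second letter of a block and both blocks carry increasing palindromic lengths. -/
theorem exists_palOn_four_mul (hP : ∀ n, P b n = tmPalLen n) (k : ℕ) :
    (∃ l ≤ k, PalOn b (4 * l) (4 * k + 4) ∧ tmPalLen l + 1 = tmPalLen (k + 1) ∧
      (tmPalLen (k + 1) ≤ tmPalLen k → tmPalLen l ≤ tmPalLen (l + 1))) ∨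
    (∃ l < k, PalOn b (4 * l + 1) (4 * k + 4) ∧ tmPalLen (k + 1) = tmPalLen k + 1 ∧
      tmPalLen k = tmPalLen (l + 1) ∧ tmPalLen (l + 1) = tmPalLen l + 1) := by
  obtain ⟨m, hm, hp, hq⟩ := exists_palOn_P_succ_le b (show 0 < 4 * k + 4 by omega)
  have d0 := hp.tmPalLen_le_of_P_eq hP hm.le
  rw [hP, hP] at hq
  have e0 := tmPalLen_four_mul k
  have e1 := tmPalLen_four_mul_add_one k
  have e2 := tmPalLen_four_mul_add_two k
  have e3 := tmPalLen_four_mul_add_three k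
  have e4 : tmPalLen (4 * k + 4) = tmPalLen (k + 1) := tmPalLen_four_mul (k + 1)
  have hs := tmPalLen_succ k
  have hm1 : m ≠ 4 * k + 1 := by rintro rfl; omega
  have hm2 : m ≠ 4 * k + 2 := by rintro rfl; omega
  have hm3 : m ≠ 4 * k + 3 := by rintro rfl; omega
  have d1 := (hp.central (m' := m + 1) (n' := 4 * k + 3) (by omega) (by omega)).tmPalLen_le_of_P_eq
    hP (by omega)
  have d2 := (hp.central (m' := m + 2) (n' := 4 * k + 2) (by omega) (by omega)).tmPalLen_le_of_P_eq
    hP (by omega)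
  have s0 := tmPalLen_succ m
  have s1 := tmPalLen_succ (m + 1)
  rw [show m + 1 + 1 = m + 2 from rfl] at s1
  by_cases hm0 : tmPalLen (m + 2) = tmPalLen m + 2
  · obtain ⟨l, rfl, hl⟩ := exists_eq_four_mul_of_increasing (by omega) hm0
    exact Or.inl ⟨l, by omega, hp, by rw [tmPalLen_four_mul] at hq d0; omega, fun _ => hl⟩
  have hk : tmPalLen (k + 1) = tmPalLen k + 1 := by omega
  obtain ⟨l, hl⟩ := exists_four_mul_add m
  have f0 := tmPalLen_four_mul l
  have f1 := tmPalLen_four_mul_add_one l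
  have f2 := tmPalLen_four_mul_add_two l
  have f3 := tmPalLen_four_mul_add_three l
  have f4 : tmPalLen (4 * l + 4) = tmPalLen (l + 1) := tmPalLen_four_mul (l + 1)
  rcases hl with rfl | rfl | rfl | rfl
  · exact Or.inl ⟨l, by omega, hp, by omega, fun _ => by omega⟩
  · simp only [Nat.add_assoc, Nat.reduceAdd] at d1 d2 s0 s1 hm0
    exact Or.inr ⟨l, by omega, hp, hk, by omega, by omega⟩
  all_goals
    simp only [Nat.add_assoc, Nat.reduceAdd] at d1 d2 s0 s1 hm0
    omega

/-- The block of length four of `b` at position `4 * k` has the form `x y y x` with `x ≠ y`. -/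
def IsXyyxBlock {β : Type*} (b : ℕ → β) (k : ℕ) : Prop :=
  b (4 * k) = b (4 * k + 3) ∧ b (4 * k + 1) = b (4 * k + 2) ∧ b (4 * k) ≠ b (4 * k + 1)

/-- In a palindrome made of blocks, the last block mirrors the first one. -/
theorem PalOn.isXyyxBlock {l k : ℕ} (h : PalOn b (4 * l) (4 * k + 4)) (hlk : l ≤ k)
    (hl : IsXyyxBlock b l) : IsXyyxBlock b k := by
  obtain ⟨h1, h2, h3⟩ := hl
  have e0 := h (4 * k) (4 * l + 3) (by omega) (by omega) (by omega)
  have e1 := h (4 * k + 1) (4 * l + 2) (by omega) (by omega) (by omega)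
  have e2 := h (4 * k + 2) (4 * l + 1) (by omega) (by omega) (by omega)
  have e3 := h (4 * k + 3) (4 * l) (by omega) (by omega) (by omega)
  exact ⟨by rw [e0, e3, h1], by rw [e1, e2, h2], by rwa [e0, e1, ← h1, ← h2]⟩

/-- A misaligned optimal palindrome is incompatible with well-formed preceding blocks. -/
theorem not_palOn_four_mul_add_one (hP : ∀ n, P b n = tmPalLen n) {k l : ℕ} (hlk : l < k)
    (ih : ∀ j < k, IsXyyxBlock b j) (h : PalOn b (4 * l + 1) (4 * k + 4))
    (hk : tmPalLen (k + 1) = tmPalLen k + 1) (hl : tmPalLen k = tmPalLen (l + 1))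
    (hl' : tmPalLen (l + 1) = tmPalLen l + 1) : False := by
  obtain ⟨l1, l2, -⟩ := ih l hlk
  have hne := apply_ne_apply_succ hP (k := k) (by omega)
  rcases (by omega : k = l + 1 ∨ l + 1 < k) with rfl | hlt
  · have e1 := h (4 * (l + 1) + 3) (4 * l + 1) (by omega) (by omega) (by omega)
    have e2 := h (4 * (l + 1) + 2) (4 * l + 2) (by omega) (by omega) (by omega)
    have e23 : b (4 * (l + 1) + 2) = b (4 * (l + 1) + 3) := by rw [e1, e2, l2]
    have hbad : ¬ IsXyyxBlock b (l + 1) := fun ⟨g1, g2, g3⟩ => g3 (by rw [g1, g2, e23])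
    have hs : tmPalLen (l + 3) ≤ tmPalLen (l + 2) := by
      have h2 : tmPalLen (l + 2) = tmPalLen l + 2 := by
        rw [show l + 2 = l + 1 + 1 from rfl]; omega
      obtain ⟨u, rfl, -⟩ := exists_eq_four_mul_of_increasing hl' h2
      have := tmPalLen_four_mul_add_two u
      have := tmPalLen_four_mul_add_three u
      have := tmPalLen_succ u
      omega
    rcases exists_palOn_four_mul hP (l + 2) with ⟨j, hj, hp, hq, hi⟩ | ⟨j, -, -, hq, -⟩
    · have hjne : j ≠ l + 2 := by
        rintro rfl
        rw [show l + 2 + 1 = l + 3 from rfl] at hq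
        omega
      rcases (by omega : j = l + 1 ∨ j < l + 1) with rfl | hjlt
      · have g1 := hp (4 * (l + 2)) (4 * (l + 1) + 3) (by omega) (by omega) (by omega)
        have g2 := hp (4 * (l + 2) + 1) (4 * (l + 1) + 2) (by omega) (by omega) (by omega)
        refine apply_ne_apply_succ hP (k := l + 2) ?_ (by rw [g1, g2, e23])
        rw [show l + 1 + 1 = l + 2 from rfl] at *
        omega
      · have hc : PalOn b (4 * (j + 1)) (4 * (l + 1) + 4) := hp.central (by omega) (by omega)
        rcases (by omega : j + 1 = l + 1 ∨ j + 1 < l + 1) with hj1 | hj1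
        · rw [hj1] at hc
          have g1 := hc (4 * (l + 1)) (4 * (l + 1) + 3) (by omega) (by omega) (by omega)
          have g2 := hc (4 * (l + 1) + 1) (4 * (l + 1) + 2) (by omega) (by omega) (by omega)
          exact hne (by rw [g1, g2, e23])
        · exact hbad (hc.isXyyxBlock (by omega) (ih _ hj1))
    · rw [show l + 2 + 1 = l + 3 from rfl] at hq
      omega
  · obtain ⟨k, rfl⟩ : ∃ i, k = i + 1 := ⟨k - 1, by omega⟩
    obtain ⟨k1, k2, k3⟩ := ih k (by omega)
    obtain ⟨j1, j2, j3⟩ := ih (l + 1) hlt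
    have e1 := h (4 * k + 3) (4 * (l + 1) + 1) (by omega) (by omega) (by omega)
    have e2 := h (4 * k + 2) (4 * (l + 1) + 2) (by omega) (by omega) (by omega)
    exact k3 (by rw [k1, k2, e1, e2, j2])

theorem isXyyxBlock_of_P_eq (hP : ∀ n, P b n = tmPalLen n) (k : ℕ) : IsXyyxBlock b k := by
  induction k using Nat.strong_induction_on with
  | _ k ih =>
    rcases exists_palOn_four_mul hP k with ⟨l, hl, hp, hq, hi⟩ | ⟨l, hl, hp, hk, h1, h2⟩
    · rcases hl.eq_or_lt with rfl | hlt
      · exact ⟨hp _ _ (by omega) (by omega) (by omega), hp _ _ (by omega) (by omega) (by omega),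
          apply_ne_apply_succ hP (by omega)⟩
      · exact hp.isXyyxBlock hl (ih l hlt)
    · exact (not_palOn_four_mul_add_one hP hl ih hp hk h1 h2).elim

end Reconstruction

theorem stmt15 {β : Type*} (b : ℕ → β)
    (hP : ∀ n : ℕ, P b n = P thueMorse n) :
    ∀ k : ℕ, b (4 * k) = b (4 * k + 3) ∧ b (4 * k + 1) = b (4 * k + 2) ∧
      b (4 * k) ≠ b (4 * k + 1) :=
  isXyyxBlock_of_P_eq fun n => (hP n).trans (P_thueMorse n)
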